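/- Let G be a discrete group and L a proper length function on G. Let t > s > 2r > 0, set k = |B(r)|⁻¹·χ_{B(r)}, h = χ_{A(s,t)}, and g = h* ∗ k. Then for every finitely supported f : G → ℂ one has ‖λ_{g·f}‖ ≤ r⁻¹ · (|B(t)|/|B(r)|)^{1/2} · J_D(f) and J_D(g·f) ≤ (|B(t)|/|B(r)|)^{1/2} · J_D(f), where g·f denotes the pointwise product. -/

import Mathlib

open scoped ENNReal ComplexConjugate

noncomputable section

variable {G : Type*}

/-- The Hilbert space `ℓ²(G)` of square-summable complex-valued functions on `G`. -/
abbrev l2 (G : Type*) : Type _ := lp (fun _ : G => ℂ) 2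

variable [Group G]

/-- A length function on a group `G`: subadditive, symmetric under inverses,
and vanishing exactly at the identity. -/
structure IsLengthFunction (L : G → ℝ) : Prop where
  nonneg : ∀ x, 0 ≤ L x
  subadd : ∀ x y, L (x * y) ≤ L x + L y
  inv_eq : ∀ x, L x⁻¹ = L x
  eq_zero_iff : ∀ x, L x = 0 ↔ x = 1

/-- The ball `B(r) = {x ∈ G : L x ≤ r}`. -/
def lball (L : G → ℝ) (r : ℝ) : Set G := {x : G | L x ≤ r}

/-- A length function is proper if all balls are finite. -/
def IsProperLF (L : G → ℝ) : Prop := ∀ r : ℝ, (lball L r).Finite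

/-- Bounded doubling: `L` is proper and there is `C < ∞` with
`|B(2r)| ≤ C |B(r)|` for all `r ≥ 1`. -/
def HasBoundedDoubling (L : G → ℝ) : Prop :=
  IsProperLF L ∧ ∃ C : ℝ, ∀ r : ℝ, 1 ≤ r →
    ((lball L (2 * r)).ncard : ℝ) ≤ C * ((lball L r).ncard : ℝ)

/-- `T` is the convolution operator `λ_f`, `(λ_f ξ)(x) = Σ_y f(xy⁻¹) ξ(y)`. -/
def IsConvOp (f : G → ℂ) (T : l2 G →L[ℂ] l2 G) : Prop :=
  ∀ (ξ : l2 G) (x : G), T ξ x = ∑' y : G, f (x * y⁻¹) * ξ y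

/-- `T` is the commutator `[D, λ_f]` for `D = M_L`, i.e.
`([D,λ_f] ξ)(x) = Σ_y (L x − L y) f(xy⁻¹) ξ(y)`. -/
def IsCommOp (L : G → ℝ) (f : G → ℂ) (T : l2 G →L[ℂ] l2 G) : Prop :=
  ∀ (ξ : l2 G) (x : G), T ξ x = ∑' y : G, ((L x : ℂ) - (L y : ℂ)) * f (x * y⁻¹) * ξ y

/-- `T` is the truncated operator `(I − M_{2r}) λ_f M_r`. -/
def IsTruncOp (L : G → ℝ) (f : G → ℂ) (r : ℝ) (T : l2 G →L[ℂ] l2 G) : Prop :=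
  ∀ (ξ : l2 G) (x : G),
    T ξ x = if L x ≤ 2 * r then 0
      else ∑' y : G, (if L y ≤ r then f (x * y⁻¹) * ξ y else 0)

/-- The seminorm `J_D(f) = sup_{r>0} r ‖(I − M_{2r}) λ_f M_r‖`. -/
def JD (L : G → ℝ) (f : G → ℂ) : ℝ :=
  sSup {a : ℝ | ∃ r : ℝ, 0 < r ∧ ∃ T : l2 G →L[ℂ] l2 G, IsTruncOp L f r T ∧ a = r * ‖T‖}

/-- The convolution `h* ∗ k`, where `h*(z) = conj (h z⁻¹)`. -/
def starConv (h k : G → ℂ) : G → ℂ :=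
  fun x => ∑' z : G, conj (h z⁻¹) * k (z⁻¹ * x)

/-- The `ℓ²` norm `‖h‖₂ = (Σ_x |h x|²)^{1/2}` of a function `h : G → ℂ`. -/
def l2norm (h : G → ℂ) : ℝ := Real.sqrt (∑' x : G, ‖h x‖ ^ 2)

section MatrixEntries

variable {α : Type*}

theorem norm_sum_mul_le_sqrt_mul_sqrt (F : Finset α) (u v : α → ℂ) :
    ‖∑ x ∈ F, u x * v x‖ ≤ √(∑ x ∈ F, ‖u x‖ ^ 2) * √(∑ x ∈ F, ‖v x‖ ^ 2) := by
  refine (norm_sum_le _ _).trans ?_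
  simp only [norm_mul]
  exact Real.sum_mul_le_sqrt_mul_sqrt _ _ _

/-- The bilinear form of a matrix whose entries are multiplied by `∑ z, h z x * k z y`. -/
theorem norm_form_schur_le {β : Type*} (K : α → α → ℂ) (h k : β → α → ℂ) (F : Finset α)
    (Z : Finset β) {a b C : ℝ} (hC : 0 ≤ C)
    (hk : ∀ y, ∑ z ∈ Z, ‖k z y‖ ^ 2 ≤ a) (hh : ∀ x, ∑ z ∈ Z, ‖h z x‖ ^ 2 ≤ b)
    (ξ η : α → ℂ)
    (hloc : ∀ z ∈ Z, ‖∑ x ∈ F, ∑ y ∈ F, K x y * (k z y * ξ y) * (h z x * η x)‖ ≤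
      C * √(∑ y ∈ F, ‖k z y * ξ y‖ ^ 2) * √(∑ x ∈ F, ‖h z x * η x‖ ^ 2)) :
    ‖∑ x ∈ F, ∑ y ∈ F, (∑ z ∈ Z, h z x * k z y) * K x y * ξ y * η x‖ ≤
      (√b * √a * C) * √(∑ y ∈ F, ‖ξ y‖ ^ 2) * √(∑ x ∈ F, ‖η x‖ ^ 2) := by
  have hsum : ∀ (m : β → α → ℂ) (c : ℝ) (ζ : α → ℂ), (∀ y, ∑ z ∈ Z, ‖m z y‖ ^ 2 ≤ c) →
      ∑ z ∈ Z, ∑ y ∈ F, ‖m z y * ζ y‖ ^ 2 ≤ c * ∑ y ∈ F, ‖ζ y‖ ^ 2 := by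
    intro m c ζ hm
    rw [Finset.sum_comm, Finset.mul_sum]
    refine Finset.sum_le_sum fun y _ => ?_
    simp only [norm_mul, mul_pow, ← Finset.sum_mul]
    exact mul_le_mul_of_nonneg_right (hm y) (by positivity)
  have hswap : ∑ x ∈ F, ∑ y ∈ F, (∑ z ∈ Z, h z x * k z y) * K x y * ξ y * η x =
      ∑ z ∈ Z, ∑ x ∈ F, ∑ y ∈ F, K x y * (k z y * ξ y) * (h z x * η x) := by
    rw [Finset.sum_comm (s := Z)]
    refine Finset.sum_congr rfl fun x _ => ?_
    rw [Finset.sum_comm (s := Z)]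
    refine Finset.sum_congr rfl fun y _ => ?_
    simp only [Finset.sum_mul]
    exact Finset.sum_congr rfl fun z _ => by ring
  have hcs : ∑ z ∈ Z, √(∑ y ∈ F, ‖k z y * ξ y‖ ^ 2) * √(∑ x ∈ F, ‖h z x * η x‖ ^ 2) ≤
      √(a * ∑ y ∈ F, ‖ξ y‖ ^ 2) * √(b * ∑ x ∈ F, ‖η x‖ ^ 2) := by
    refine (Real.sum_sqrt_mul_sqrt_le _ (fun _ => by positivity) (fun _ => by positivity)).trans ?_
    gcongr
    · exact hsum k a ξ hk
    · exact hsum h b η hh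
  rw [hswap]
  refine (norm_sum_le _ _).trans ((Finset.sum_le_sum hloc).trans ?_)
  simp only [mul_assoc C, ← Finset.mul_sum]
  refine (mul_le_mul_of_nonneg_left hcs hC).trans (le_of_eq ?_)
  rw [Real.sqrt_mul' _ (by positivity), Real.sqrt_mul' _ (by positivity)]
  ring

variable [DecidableEq α]

theorem clm_sum_single_apply (T : l2 α →L[ℂ] l2 α) (F : Finset α) (ξ : α → ℂ) (x : α) :
    T (∑ y ∈ F, lp.single 2 y (ξ y)) x = ∑ y ∈ F, T (lp.single 2 y 1) x * ξ y := by
  rw [map_sum, lp.coeFn_sum, Finset.sum_apply]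
  refine Finset.sum_congr rfl fun y _ => ?_
  have h : (lp.single 2 y (ξ y) : l2 α) = ξ y • lp.single 2 y (1 : ℂ) := by
    rw [← lp.single_smul, smul_eq_mul, mul_one]
  rw [h, map_smul, lp.coeFn_smul, Pi.smul_apply, smul_eq_mul, mul_comm]

theorem l2_norm_sum_single (F : Finset α) (ξ : α → ℂ) :
    ‖(∑ y ∈ F, lp.single 2 y (ξ y) : l2 α)‖ = √(∑ y ∈ F, ‖ξ y‖ ^ 2) := by
  have h := lp.norm_sum_single (p := 2) (by norm_num) ξ F
  simp only [ENNReal.toReal_ofNat, Real.rpow_ofNat] at h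
  rw [← h, Real.sqrt_sq (norm_nonneg _)]

/-- An operator on `ℓ²` bounds the bilinear form of its matrix. -/
theorem norm_form_le_opNorm (T : l2 α →L[ℂ] l2 α) (F : Finset α) (ξ η : α → ℂ) :
    ‖∑ x ∈ F, ∑ y ∈ F, T (lp.single 2 y 1) x * ξ y * η x‖ ≤
      ‖T‖ * √(∑ y ∈ F, ‖ξ y‖ ^ 2) * √(∑ x ∈ F, ‖η x‖ ^ 2) := by
  simp only [← Finset.sum_mul, ← clm_sum_single_apply]
  refine (norm_sum_mul_le_sqrt_mul_sqrt _ _ _).trans ?_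
  gcongr
  rw [← l2_norm_sum_single F ξ]
  refine le_trans (Real.sqrt_le_iff.mpr ⟨norm_nonneg _, ?_⟩) (T.le_opNorm _)
  simpa using lp.sum_rpow_le_norm_rpow (p := 2) (by norm_num)
    (T (∑ y ∈ F, lp.single 2 y (ξ y))) F

/-- A bound on the bilinear form of its matrix bounds an operator on `ℓ²`. -/
theorem opNorm_le_of_form_le (T : l2 α →L[ℂ] l2 α) {C : ℝ} (hC : 0 ≤ C)
    (h : ∀ (F : Finset α) (ξ η : α → ℂ),
      ‖∑ x ∈ F, ∑ y ∈ F, T (lp.single 2 y 1) x * ξ y * η x‖ ≤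
        C * √(∑ y ∈ F, ‖ξ y‖ ^ 2) * √(∑ x ∈ F, ‖η x‖ ^ 2)) :
    ‖T‖ ≤ C := by
  have key : ∀ (F : Finset α) (ξ : α → ℂ),
      ‖T (∑ y ∈ F, lp.single 2 y (ξ y))‖ ≤ C * ‖(∑ y ∈ F, lp.single 2 y (ξ y) : l2 α)‖ := by
    intro F ξ
    refine lp.norm_le_of_forall_sum_le (by norm_num) (by positivity) fun F' => ?_
    simp only [ENNReal.toReal_ofNat, Real.rpow_ofNat]
    set v := T (∑ y ∈ F, lp.single 2 y (ξ y)) with hv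
    set S := √(∑ x ∈ F ∪ F', ‖v x‖ ^ 2) with hS
    have hSS : S ^ 2 = ∑ x ∈ F ∪ F', ‖v x‖ ^ 2 := Real.sq_sqrt (by positivity)
    have hext : ∀ x, ∑ y ∈ F ∪ F', T (lp.single 2 y 1) x * (if y ∈ F then ξ y else 0) = v x := by
      intro x
      rw [hv, clm_sum_single_apply, ← Finset.sum_subset Finset.subset_union_left]
      · exact Finset.sum_congr rfl fun y hy => by rw [if_pos hy]
      · intro y _ hy
        rw [if_neg hy, mul_zero]
    have hnorm : √(∑ y ∈ F ∪ F', ‖if y ∈ F then ξ y else 0‖ ^ 2) =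
        ‖(∑ y ∈ F, lp.single 2 y (ξ y) : l2 α)‖ := by
      rw [l2_norm_sum_single, ← Finset.sum_subset Finset.subset_union_left]
      · exact congrArg _ (Finset.sum_congr rfl fun y hy => by rw [if_pos hy])
      · intro y _ hy
        simp [hy]
    have h1 := h (F ∪ F') (fun y => if y ∈ F then ξ y else 0) (fun x => conj (v x))
    simp only [← Finset.sum_mul, hext, hnorm, Complex.mul_conj', RCLike.norm_conj] at h1
    have h2 : S ^ 2 ≤ C * ‖(∑ y ∈ F, lp.single 2 y (ξ y) : l2 α)‖ * S := by
      refine le_trans (le_of_eq ?_) h1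
      rw [hSS]
      norm_cast
      rw [Real.norm_of_nonneg (by positivity)]
    have h3 : S ≤ C * ‖(∑ y ∈ F, lp.single 2 y (ξ y) : l2 α)‖ := by
      rcases (Real.sqrt_nonneg _ : 0 ≤ S).eq_or_lt with h0 | h0
      · exact h0.symm.le.trans (by positivity)
      · rw [sq] at h2
        exact le_of_mul_le_mul_right h2 h0
    calc ∑ x ∈ F', ‖v x‖ ^ 2 ≤ ∑ x ∈ F ∪ F', ‖v x‖ ^ 2 :=
          Finset.sum_le_sum_of_subset_of_nonneg Finset.subset_union_right
            fun _ _ _ => by positivity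
      _ = S ^ 2 := hSS.symm
      _ ≤ _ := by gcongr
  refine T.opNorm_le_bound hC fun ξ => ?_
  have hlim : Filter.Tendsto (fun F : Finset α => ∑ y ∈ F, (lp.single 2 y (ξ y) : l2 α))
      Filter.atTop (nhds ξ) := lp.hasSum_single (by norm_num) ξ
  exact le_of_tendsto_of_tendsto' ((T.continuous.tendsto ξ).comp hlim).norm
    (hlim.norm.const_mul C) fun F => key F ξ

/-- A finitely supported matrix defines a bounded operator on `ℓ²`. -/
theorem exists_clm_of_finite_kernel (K : α → α → ℂ) (P Q : Finset α)
    (hP : ∀ x y, x ∉ P → K x y = 0) (hQ : ∀ x y, y ∉ Q → K x y = 0) :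
    ∃ T : l2 α →L[ℂ] l2 α, (∀ ξ x, T ξ x = ∑' y, K x y * ξ y) ∧
      ‖T‖ ≤ ∑ x ∈ P, ∑ y ∈ Q, ‖K x y‖ := by
  refine ⟨∑ x ∈ P, ∑ y ∈ Q, K x y •
    InnerProductSpace.rankOne ℂ (lp.single 2 x 1 : l2 α) (lp.single 2 y 1 : l2 α), ?_, ?_⟩
  · intro ξ x
    rw [tsum_eq_sum (s := Q) fun y hy => by rw [hQ x y hy, zero_mul]]
    simp only [sum_apply, smul_apply,
      InnerProductSpace.rankOne_apply, lp.inner_single_left, lp.coeFn_sum, Finset.sum_apply,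
      lp.coeFn_smul, Pi.smul_apply, lp.single_apply, Pi.single_apply, smul_eq_mul]
    by_cases hx : x ∈ P
    · rw [Finset.sum_eq_single_of_mem x hx]
      · simp
      · intro b _ hb
        simp [hb.symm]
    · rw [Finset.sum_eq_zero, Finset.sum_eq_zero]
      · intro y _
        rw [hP x y hx, zero_mul]
      · intro b hb
        have : x ≠ b := fun e => hx (e ▸ hb)
        simp [this]
  · refine (norm_sum_le _ _).trans (Finset.sum_le_sum fun x _ => ?_)
    refine (norm_sum_le _ _).trans (Finset.sum_le_sum fun y _ => ?_)
    rw [norm_smul, InnerProductSpace.norm_rankOne, lp.norm_single (by norm_num),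
      lp.norm_single (by norm_num)]
    simp

theorem entry_eq_of_kernel {K : α → α → ℂ} {T : l2 α →L[ℂ] l2 α}
    (h : ∀ ξ x, T ξ x = ∑' y, K x y * ξ y) (x y : α) : T (lp.single 2 y 1) x = K x y := by
  rw [h, tsum_eq_single y]
  · simp
  · intro b hb
    simp [hb]

end MatrixEntries

/-- The matrix of the truncated operator `(I − M_{2r}) λ_f M_r`. -/
def truncKernel (L : G → ℝ) (f : G → ℂ) (r : ℝ) (x y : G) : ℂ :=
  if L x ≤ 2 * r then 0 else if L y ≤ r then f (x * y⁻¹) else 0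

theorem isTruncOp_iff (L : G → ℝ) (f : G → ℂ) (r : ℝ) (T : l2 G →L[ℂ] l2 G) :
    IsTruncOp L f r T ↔ ∀ ξ x, T ξ x = ∑' y, truncKernel L f r x y * ξ y := by
  refine forall₂_congr fun ξ x => ?_
  by_cases hx : L x ≤ 2 * r <;> simp [truncKernel, hx]

theorem JD_nonneg (L : G → ℝ) (f : G → ℂ) : 0 ≤ JD L f := by
  refine Real.sSup_nonneg ?_
  rintro a ⟨ρ, hρ, T, -, rfl⟩
  positivity

/-- For finitely supported `f`, the truncated operators exist and the supremum defining `J_D(f)`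
bounds each of them. -/
theorem exists_isTruncOp_mul_norm_le_JD {L : G → ℝ} (hL : IsLengthFunction L)
    (hprop : IsProperLF L) (f : G →₀ ℂ) {ρ : ℝ} (hρ : 0 < ρ) :
    ∃ T : l2 G →L[ℂ] l2 G, IsTruncOp L f ρ T ∧ ρ * ‖T‖ ≤ JD L f := by
  classical
  obtain ⟨R, hR⟩ := (f.support.image L).bddAbove
  have hfR : ∀ a, f a ≠ 0 → L a ≤ R := fun a ha =>
    hR (Finset.mem_coe.mpr (Finset.mem_image_of_mem L (Finsupp.mem_support_iff.mpr ha)))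
  have hsupp : ∀ ρ x y, truncKernel L f ρ x y ≠ 0 → ρ < R ∧ L x ≤ 2 * R ∧ L y ≤ R := by
    intro ρ x y h
    unfold truncKernel at h
    split_ifs at h with h1 h2
    · exact absurd rfl h
    · have h3 := hfR _ h
      have h4 : L x ≤ L (x * y⁻¹) + L y := by simpa using hL.subadd (x * y⁻¹) y
      refine ⟨by linarith, by linarith, by linarith⟩
    · exact absurd rfl h
  have hop : ∀ ρ, ∃ T : l2 G →L[ℂ] l2 G,
      (∀ ξ x, T ξ x = ∑' y, truncKernel L f ρ x y * ξ y) ∧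
      ‖T‖ ≤ ∑ x ∈ (hprop (2 * R)).toFinset, ∑ y ∈ (hprop R).toFinset,
        ‖truncKernel L f ρ x y‖ := by
    intro ρ
    refine exists_clm_of_finite_kernel _ _ _ (fun x y hx => ?_) (fun x y hy => ?_)
    · by_contra h
      exact hx (by simpa [lball] using (hsupp ρ x y h).2.1)
    · by_contra h
      exact hy (by simpa [lball] using (hsupp ρ x y h).2.2)
  have hbdd : BddAbove {a : ℝ | ∃ r : ℝ, 0 < r ∧ ∃ T : l2 G →L[ℂ] l2 G,
      IsTruncOp L f r T ∧ a = r * ‖T‖} := by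
    refine ⟨∑ x ∈ (hprop (2 * R)).toFinset, ∑ y ∈ (hprop R).toFinset,
      |R| * ‖f (x * y⁻¹)‖, ?_⟩
    rintro _ ⟨σ, hσ, T, hT, rfl⟩
    obtain ⟨T', hT', hle⟩ := hop σ
    rw [isTruncOp_iff] at hT
    obtain rfl : T = T' := by
      ext ξ x
      rw [hT, hT']
    refine (mul_le_mul_of_nonneg_left hle hσ.le).trans ?_
    simp only [Finset.mul_sum]
    refine Finset.sum_le_sum fun x _ => Finset.sum_le_sum fun y _ => ?_
    by_cases h : truncKernel L f σ x y = 0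
    · rw [h, norm_zero, mul_zero]
      positivity
    · refine mul_le_mul ((hsupp σ x y h).1.le.trans (le_abs_self R)) ?_ (norm_nonneg _)
        (abs_nonneg R)
      unfold truncKernel
      split_ifs <;> simp
  obtain ⟨T, hT, -⟩ := hop ρ
  rw [← isTruncOp_iff] at hT
  exact ⟨T, hT, le_csSup hbdd ⟨ρ, hρ, T, hT, rfl⟩⟩

/-- The function `h* ∗ k` evaluated at `x y⁻¹`, as a sum over right translates. -/
theorem starConv_mul_inv (h k : G → ℂ) (x y : G) (Z : Finset G)
    (hZ : ∀ z, h (z * x⁻¹) ≠ 0 → z ∈ Z) :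
    starConv h k (x * y⁻¹) = ∑ z ∈ Z, conj (h (z * x⁻¹)) * k (z * y⁻¹) := by
  unfold starConv
  rw [← ((Equiv.inv G).trans (Equiv.mulLeft x)).tsum_eq, tsum_eq_sum (s := Z)]
  · simp [mul_assoc]
  · intro z hz
    have : h (z * x⁻¹) = 0 := by
      by_contra h0
      exact hz (hZ z h0)
    simp [this]

theorem card_filter_translate_le {L : G → ℝ} (hprop : IsProperLF L) (r : ℝ) (Z : Finset G)
    (y : G) : (Z.filter fun z => L (z * y⁻¹) ≤ r).card ≤ (lball L r).ncard := by
  rw [Set.ncard_eq_toFinset_card _ (hprop r)]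
  refine Finset.card_le_card_of_injOn (fun z => z * y⁻¹) (fun z hz => ?_)
    (mul_left_injective y⁻¹).injOn
  simpa [lball] using (Finset.mem_filter.mp hz).2

/-- The function `h* ∗ k` with `h = χ_{A(s,t)}` and `k = |B(r)|⁻¹ χ_{B(r)}`. -/
def annulusCutoff (L : G → ℝ) (r s t : ℝ) : G → ℂ :=
  starConv (fun y => if s < L y ∧ L y ≤ t then (1 : ℂ) else 0)
    (fun y => ((lball L r).ncard : ℂ)⁻¹ * (if L y ≤ r then 1 else 0))

/-- A matrix whose form is bounded on pairs of functions supported in translates of `B(r)` and of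
the complement of `B(s)` remains bounded after multiplication by the annulus cutoff. -/
theorem norm_form_annulusCutoff_le {L : G → ℝ} (hL : IsLengthFunction L) (hprop : IsProperLF L)
    {r s t : ℝ} (hr : 0 < r) (K : G → G → ℂ) {C : ℝ} (hC : 0 ≤ C) (F : Finset G)
    (hloc : ∀ (z : G) (ξ η : G → ℂ), (∀ y, r < L (z * y⁻¹) → ξ y = 0) →
      (∀ x, L (z * x⁻¹) ≤ s → η x = 0) →
      ‖∑ x ∈ F, ∑ y ∈ F, K x y * ξ y * η x‖ ≤
        C * √(∑ y ∈ F, ‖ξ y‖ ^ 2) * √(∑ x ∈ F, ‖η x‖ ^ 2))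
    (ξ η : G → ℂ) :
    ‖∑ x ∈ F, ∑ y ∈ F, annulusCutoff L r s t (x * y⁻¹) * K x y * ξ y * η x‖ ≤
      (√(((lball L t).ncard : ℝ) / ((lball L r).ncard : ℝ)) * C) *
        √(∑ y ∈ F, ‖ξ y‖ ^ 2) * √(∑ x ∈ F, ‖η x‖ ^ 2) := by
  classical
  set h : G → ℂ := fun y => if s < L y ∧ L y ≤ t then (1 : ℂ) else 0 with hh
  set k : G → ℂ := fun y => ((lball L r).ncard : ℂ)⁻¹ * (if L y ≤ r then 1 else 0) with hk
  set Z : Finset G := ((hprop t).toFinset ×ˢ F).image (fun p => p.1 * p.2) with hZ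
  have hpos : (0 : ℝ) < (lball L r).ncard := by
    have h1 : (1 : G) ∈ lball L r := by
      simpa [lball, (hL.eq_zero_iff 1).mpr rfl] using hr.le
    exact_mod_cast (Set.ncard_pos (hprop r)).mpr ⟨1, h1⟩
  have hcut : ∀ x ∈ F, ∀ y, annulusCutoff L r s t (x * y⁻¹) =
      ∑ z ∈ Z, conj (h (z * x⁻¹)) * k (z * y⁻¹) := by
    intro x hx y
    refine starConv_mul_inv h k x y Z fun z hz => ?_
    have hz' : L (z * x⁻¹) ≤ t := by
      by_contra h0
      exact hz (by simp [hh, h0])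
    refine Finset.mem_image.mpr ⟨(z * x⁻¹, x), ?_, by simp⟩
    simpa [lball, hx] using hz'
  have hksum : ∀ y, ∑ z ∈ Z, ‖k (z * y⁻¹)‖ ^ 2 ≤ ((lball L r).ncard : ℝ)⁻¹ := by
    intro y
    have h1 : ∀ z, ‖k (z * y⁻¹)‖ ^ 2 =
        if L (z * y⁻¹) ≤ r then (((lball L r).ncard : ℝ)⁻¹) ^ 2 else 0 := by
      intro z
      simp only [hk]
      split_ifs <;> simp
    simp only [h1]
    rw [← Finset.sum_filter, Finset.sum_const, nsmul_eq_mul]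
    calc _ ≤ ((lball L r).ncard : ℝ) * (((lball L r).ncard : ℝ)⁻¹) ^ 2 := by
          gcongr
          exact card_filter_translate_le hprop r Z y
      _ = _ := by field_simp
  have hhsum : ∀ x, ∑ z ∈ Z, ‖conj (h (z * x⁻¹))‖ ^ 2 ≤ ((lball L t).ncard : ℝ) := by
    intro x
    have h1 : ∀ z, ‖conj (h (z * x⁻¹))‖ ^ 2 ≤ if L (z * x⁻¹) ≤ t then (1 : ℝ) else 0 := by
      intro z
      by_cases h2 : L (z * x⁻¹) ≤ t <;> by_cases h3 : s < L (z * x⁻¹) <;> simp [hh, h2, h3]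
    refine (Finset.sum_le_sum fun z _ => h1 z).trans ?_
    rw [← Finset.sum_filter, Finset.sum_const, nsmul_eq_mul, mul_one]
    exact_mod_cast card_filter_translate_le hprop t Z x
  have hmain := norm_form_schur_le K (fun z x => conj (h (z * x⁻¹))) (fun z y => k (z * y⁻¹)) F Z
    hC hksum hhsum ξ η fun z _ => hloc z _ _
      (fun y hy => by simp [hk, not_le.mpr hy])
      (fun x hx => by simp [hh, not_lt.mpr hx])
  have hsqrt : √(((lball L t).ncard : ℝ) / ((lball L r).ncard : ℝ)) =
      √((lball L t).ncard : ℝ) * √((lball L r).ncard : ℝ)⁻¹ := by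
    rw [div_eq_mul_inv, Real.sqrt_mul (by positivity)]
  rw [hsqrt]
  refine le_trans (le_of_eq (congrArg _ ?_)) hmain
  exact Finset.sum_congr rfl fun x hx => Finset.sum_congr rfl fun y _ => by rw [hcut x hx y]

/-- By right invariance, the truncated operator bounds the form of `λ_f` on pairs of functions
supported in `B(r) z` and outside `B(s) z`. -/
theorem norm_conv_form_le {L : G → ℝ} (hL : IsLengthFunction L) {r s : ℝ} (hs : 2 * r < s)
    (f : G → ℂ) {T : l2 G →L[ℂ] l2 G} (hT : IsTruncOp L f r T) (F : Finset G) (z : G)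
    (ξ η : G → ℂ) (hξ : ∀ y, r < L (z * y⁻¹) → ξ y = 0) (hη : ∀ x, L (z * x⁻¹) ≤ s → η x = 0) :
    ‖∑ x ∈ F, ∑ y ∈ F, f (x * y⁻¹) * ξ y * η x‖ ≤
      ‖T‖ * √(∑ y ∈ F, ‖ξ y‖ ^ 2) * √(∑ x ∈ F, ‖η x‖ ^ 2) := by
  classical
  have hinv : ∀ y, L (y * z⁻¹) = L (z * y⁻¹) := fun y => by
    rw [← hL.inv_eq]
    simp
  have hform := norm_form_le_opNorm T (F.map (mulRightEmbedding z⁻¹))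
    (fun y => ξ (y * z)) (fun x => η (x * z))
  simp only [entry_eq_of_kernel ((isTruncOp_iff L f r T).mp hT), Finset.sum_map,
    mulRightEmbedding_apply, inv_mul_cancel_right] at hform
  refine le_trans (le_of_eq (congrArg _ ?_)) hform
  refine Finset.sum_congr rfl fun x _ => Finset.sum_congr rfl fun y _ => ?_
  by_cases hy : r < L (z * y⁻¹)
  · simp [hξ y hy]
  by_cases hx : L (z * x⁻¹) ≤ s
  · simp [hη x hx]
  rw [truncKernel, hinv, hinv, if_neg (by linarith), if_pos (not_lt.mp hy)]
  simp

/-- for `t > s > 2r > 0`, `k = |B(r)|⁻¹ χ_{B(r)}`, `h = χ_{A(s,t)}`,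
`g = h* ∗ k`: `‖λ_{g·f}‖ ≤ r⁻¹ (|B(t)|/|B(r)|)^{1/2} J_D(f)` and
`J_D(g·f) ≤ (|B(t)|/|B(r)|)^{1/2} J_D(f)`. -/
theorem norm_and_JD_annulus_cutoff_le
    (L : G → ℝ) (hL : IsLengthFunction L) (hprop : IsProperLF L)
    (r s t : ℝ) (hr : 0 < r) (hs : 2 * r < s) (hst : s < t)
    (f : G →₀ ℂ) (T : l2 G →L[ℂ] l2 G)
    (hT : IsConvOp (fun x =>
      starConv (fun y => if s < L y ∧ L y ≤ t then (1 : ℂ) else 0)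
        (fun y => ((lball L r).ncard : ℂ)⁻¹ * (if L y ≤ r then 1 else 0)) x * f x) T) :
    ‖T‖ ≤ r⁻¹ * Real.sqrt (((lball L t).ncard : ℝ) / ((lball L r).ncard : ℝ)) *
        JD L (f : G → ℂ) ∧
    JD L (fun x =>
        starConv (fun y => if s < L y ∧ L y ≤ t then (1 : ℂ) else 0)
          (fun y => ((lball L r).ncard : ℂ)⁻¹ * (if L y ≤ r then 1 else 0)) x * f x) ≤
      Real.sqrt (((lball L t).ncard : ℝ) / ((lball L r).ncard : ℝ)) *
        JD L (f : G → ℂ) := by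
  classical
  change IsConvOp (fun x => annulusCutoff L r s t x * f x) T at hT
  change _ ∧ JD L (fun x => annulusCutoff L r s t x * f x) ≤ _
  constructor
  · obtain ⟨S, hS, hle⟩ := exists_isTruncOp_mul_norm_le_JD hL hprop f hr
    have hST : ‖T‖ ≤ √(((lball L t).ncard : ℝ) / ((lball L r).ncard : ℝ)) * ‖S‖ := by
      refine opNorm_le_of_form_le T (by positivity) fun F ξ η => ?_
      simp only [entry_eq_of_kernel (K := fun x y =>
        annulusCutoff L r s t (x * y⁻¹) * f (x * y⁻¹)) hT]
      exact norm_form_annulusCutoff_le hL hprop hr (fun x y => f (x * y⁻¹)) (norm_nonneg S) F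
        (norm_conv_form_le hL hs f hS F) ξ η
    have hSJ : ‖S‖ ≤ r⁻¹ * JD L f := by
      rwa [le_inv_mul_iff₀ hr]
    calc ‖T‖ ≤ √(((lball L t).ncard : ℝ) / ((lball L r).ncard : ℝ)) * (r⁻¹ * JD L f) :=
          hST.trans (by gcongr)
      _ = _ := by ring
  · refine Real.sSup_le ?_ (mul_nonneg (Real.sqrt_nonneg _) (JD_nonneg L f))
    rintro _ ⟨ρ, hρ, S, hS, rfl⟩
    obtain ⟨S', hS', hle⟩ := exists_isTruncOp_mul_norm_le_JD hL hprop f hρ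
    have hSS : ‖S‖ ≤ √(((lball L t).ncard : ℝ) / ((lball L r).ncard : ℝ)) * ‖S'‖ := by
      refine opNorm_le_of_form_le S (by positivity) fun F ξ η => ?_
      have hker : ∀ x y, S (lp.single 2 y 1) x =
          annulusCutoff L r s t (x * y⁻¹) * truncKernel L f ρ x y := by
        intro x y
        rw [entry_eq_of_kernel ((isTruncOp_iff _ _ _ _).mp hS)]
        unfold truncKernel
        split_ifs <;> simp
      simp only [hker]
      refine norm_form_annulusCutoff_le hL hprop hr _ (norm_nonneg S') F ?_ ξ η
      intro z ξ η _ _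
      simpa only [entry_eq_of_kernel ((isTruncOp_iff _ _ _ _).mp hS')] using
        norm_form_le_opNorm S' F ξ η
    calc ρ * ‖S‖ ≤ ρ * (√(((lball L t).ncard : ℝ) / ((lball L r).ncard : ℝ)) * ‖S'‖) := by
          gcongr
      _ = √(((lball L t).ncard : ℝ) / ((lball L r).ncard : ℝ)) * (ρ * ‖S'‖) := by ring
      _ ≤ _ := by gcongr
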